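/- Let A be a unital C*-algebra with finite type elements F. If t₁ and t₂ are Fredholm type elements, then t₁ t₂ is of Fredholm type and ind(t₁ t₂) = ind(t₁) + ind(t₂) in K(F). -/

import Mathlib

/-- A projection in a C*-algebra: a self-adjoint idempotent. -/
def IsProjection {A : Type*} [Ring A] [StarRing A] (p : A) : Prop :=
  star p = p ∧ p * p = p

/-- Murray–von Neumann equivalence: `p ∼ q` iff there is `v` with `v v* = p`
and `v* v = q`. -/
def MvNEquiv {A : Type*} [Ring A] [StarRing A] (p q : A) : Prop :=
  ∃ v : A, v * star v = p ∧ star v * v = q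

/-- `(u α)_{α}` (indexed by the directed set `(ι, rel)`) is an approximate unit
for `F` consisting of projections. -/
structure IsApproxUnit {A : Type*} [NormedRing A] [StarRing A] (F : Set A)
    {ι : Type} (rel : ι → ι → Prop) (u : ι → A) : Prop where
  nonempty : Nonempty ι
  directed : ∀ α β : ι, ∃ γ : ι, rel α γ ∧ rel β γ
  proj : ∀ α, IsProjection (u α)
  mem : ∀ α, u α ∈ F
  approx : ∀ f ∈ F, ∀ ε : ℝ, 0 < ε → ∃ α, ∀ β, rel α β → ‖f - u β * f‖ < ε

/-- `F` is an algebra of finite type elements: a self-adjoint two-sided ideal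
with an approximate unit consisting of projections, satisfying the
orthogonalization property (iii). -/
structure IsFiniteType {A : Type*} [NormedRing A] [StarRing A] (F : Set A) : Prop where
  zero_mem : (0 : A) ∈ F
  add_mem : ∀ a ∈ F, ∀ b ∈ F, a + b ∈ F
  mul_mem_left : ∀ (a : A), ∀ b ∈ F, a * b ∈ F
  mul_mem_right : ∀ (a : A), ∀ b ∈ F, b * a ∈ F
  star_mem : ∀ a ∈ F, star a ∈ F
  approx_unit : ∃ (ι : Type) (rel : ι → ι → Prop) (u : ι → A), IsApproxUnit F rel u
  orth : ∀ p ∈ F, ∀ q ∈ F, IsProjection p → IsProjection q →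
    ∃ v : A, v * star v = q ∧ IsProjection (star v * v + p)

/-- `b` is a `(p,q)`-inverse of `a`. -/
def IsPQInv {A : Type*} [Ring A] (a p q b : A) : Prop :=
  b = (1 - p) * b * (1 - q) ∧ (1 - q) * a * (1 - p) * b = 1 - q ∧
    b * ((1 - q) * a * (1 - p)) = 1 - p

/-- `a` is invertible up to `(p,q)`. -/
def InvUpTo {A : Type*} [Ring A] (a p q : A) : Prop := ∃ b, IsPQInv a p q b

/-- Equality `[p₃] - [q₃] = ([p₁] - [q₁]) + ([p₂] - [q₂])` in the Grothendieck
group `K(F)` of Murray–von Neumann classes of projections of `F`: there is a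
projection `r ∈ F` such that the direct sum `p₃ ⊕ q₁ ⊕ q₂ ⊕ r` is Murray–von
Neumann equivalent to `q₃ ⊕ p₁ ⊕ p₂ ⊕ r` (as diagonal projections in
`M₄(A)`). -/
def KDiffAddEq {A : Type*} [NormedRing A] [StarRing A] (F : Set A)
    (p₁ q₁ p₂ q₂ p₃ q₃ : A) : Prop :=
  ∃ r : A, r ∈ F ∧ IsProjection r ∧
    ∃ V : Matrix (Fin 4) (Fin 4) A,
      V * star V = Matrix.diagonal ![p₃, q₁, q₂, r] ∧
      star V * V = Matrix.diagonal ![q₃, p₁, p₂, r]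

/-- Quotient map by `F`. -/
theorem exists_quot.{u} {A : Type u} [CStarAlgebra A] {F : Set A} (hF : IsFiniteType F) :
    ∃ (B : Type u) (_ : Ring B) (π : A →+* B), ∀ x, π x = 0 ↔ x ∈ F := by
  let I : TwoSidedIdeal A := TwoSidedIdeal.mk' F hF.zero_mem
    (fun hx hy => hF.add_mem _ hx _ hy)
    (fun {x} hx => by simpa using hF.mul_mem_left (-1) x hx)
    (fun {x y} hy => hF.mul_mem_left x y hy) (fun {x y} hx => hF.mul_mem_right y x hx)
  refine ⟨I.ringCon.Quotient, inferInstance, I.ringCon.mk', fun x => ?_⟩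
  rw [← TwoSidedIdeal.mem_ker, TwoSidedIdeal.ker_ringCon_mk']
  exact TwoSidedIdeal.mem_mk' ..

theorem isProjection_one_sub {A : Type*} [Ring A] [StarRing A] {p : A} (h : IsProjection p) :
    IsProjection (1 - p) := by
  obtain ⟨h1, h2⟩ := h
  exact ⟨by simp [h1], by simp [mul_sub, sub_mul, h2]⟩

theorem proj_norm_le {A : Type*} [CStarAlgebra A] {p : A} (h : IsProjection p) : ‖p‖ ≤ 1 :=
  IsStarProjection.norm_le p ⟨h.2, h.1⟩

/-- Range projection of an idempotent. -/
theorem range_proj {A : Type*} [CStarAlgebra A] (e : A) (he : e * e = e) :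
    ∃ w, w * (1 + (e - star e) * star (e - star e)) = 1 ∧
      IsProjection (e * star e * w) ∧ e * star e * w * e = e ∧
      e * (e * star e * w) = e * star e * w := by
  let : PartialOrder A := CStarAlgebra.spectralOrder A
  let : StarOrderedRing A := CStarAlgebra.spectralOrderedRing A
  set z := 1 + (e - star e) * star (e - star e) with hz
  have hu : IsUnit z := by
    apply CStarAlgebra.isUnit_of_le (1 : A)
    · rw [hz]
      exact le_add_of_nonneg_right (mul_star_self_nonneg _)
  obtain ⟨⟨_, w, h1, h2⟩, rfl⟩ := hu
  change z * w = 1 at h1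
  change w * z = 1 at h2
  have hes : star e * star e = star e := by rw [← star_mul, he]
  have hez : e * z = z * e := by
    simp only [hz, star_sub, star_star, mul_add, add_mul, mul_sub, sub_mul, he, hes, mul_one,
      one_mul, ← mul_assoc]
    simp only [mul_assoc, he, hes]
    abel
  have hzs : star z = z := by simp [hz]
  have hesz : star e * z = z * star e := by
    have := congrArg star hez
    simpa [hzs] using this.symm
  have com : ∀ x, x * z = z * x → w * x = x * w := fun x hx => by
    calc w * x = w * (x * z) * w := by rw [mul_assoc, mul_assoc, h1, mul_one]
      _ = x * w := by rw [hx, ← mul_assoc, h2, one_mul]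
  have c1 := com _ hez
  have c2 := com _ hesz
  have hws : star w = w := by
    have : star w * z = 1 := by
      have := congrArg star h1
      simpa [hzs] using this
    calc star w = star w * (z * w) := by rw [h1, mul_one]
      _ = w := by rw [← mul_assoc, this, one_mul]
  have eze : e * star e * e = z * e := by
    simp only [hz, star_sub, star_star, mul_add, add_mul, mul_sub, sub_mul, he, hes, mul_one,
      one_mul, mul_assoc]
    abel
  have k1 : e * star e * w * e = e := by
    rw [mul_assoc, c1, ← mul_assoc, eze, ← hez, mul_assoc, h1, mul_one]
  refine ⟨w, h2, ⟨?_, ?_⟩, k1, ?_⟩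
  · rw [star_mul, star_mul, star_star, hws, ← mul_assoc, c1, mul_assoc, c2, mul_assoc]
  · calc e * star e * w * (e * star e * w) = (e * star e * w * e) * star e * w := by noncomm_ring
      _ = _ := by rw [k1]
  · rw [← mul_assoc, ← mul_assoc, he]

/-- Invertible modulo `F` implies Fredholm type. -/
theorem fredholm_of_inv {A : Type*} [CStarAlgebra A] {F : Set A} (hF : IsFiniteType F)
    {B : Type*} [Ring B] (π : A →+* B) (hπ : ∀ x, π x = 0 ↔ x ∈ F) (t s : A)
    (h1 : π s * π t = 1) (h2 : π t * π s = 1) :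
    ∃ p q : A, p ∈ F ∧ q ∈ F ∧ IsProjection p ∧ IsProjection q ∧ InvUpTo t p q := by
  have hf : star (s * t - 1) ∈ F := hF.star_mem _ ((hπ _).1 (by simp [h1]))
  obtain ⟨ι, rel, u', hu⟩ := hF.approx_unit
  obtain ⟨α, hα⟩ := hu.approx _ hf 1 one_pos
  obtain ⟨γ, hγ, -⟩ := hu.directed α α
  have hlt := hα γ hγ
  have hup := hu.proj γ
  have huF := hu.mem γ
  set u := u' γ
  have hlt' : ‖-((s * t - 1) * (1 - u))‖ < 1 := by
    rw [norm_neg, ← norm_star]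
    have e0 : star ((s * t - 1) * (1 - u)) = star (s * t - 1) - u * star (s * t - 1) := by
      rw [star_mul, (isProjection_one_sub hup).1]
      noncomm_ring
    rw [e0]
    exact hlt
  obtain ⟨x, hx⟩ : IsUnit (1 + (s * t - 1) * (1 - u)) := by
    have := (Units.oneSub _ hlt').isUnit
    simpa using this
  have hπu : π u = 0 := (hπ _).2 huF
  have hπx : π (x : A) = 1 := by rw [hx]; simp [hπu, h1]
  have hπx' : π ((x⁻¹ : Aˣ) : A) = 1 := by
    have := congrArg π x.inv_mul
    rwa [map_mul, hπx, map_one, mul_one] at this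
  obtain ⟨hu1, hu2⟩ := isProjection_one_sub hup
  have hπv : π (1 - u) = 1 := by simp [hπu]
  set v := 1 - u with hv
  have hb0 : (x⁻¹ : Aˣ) * s * (t * v) = v := by
    have : s * (t * v) = x * v := by
      rw [hx, add_mul, one_mul, mul_assoc _ v v, hu2]; noncomm_ring
    rw [mul_assoc, this, ← mul_assoc, x.inv_mul, one_mul]
  set b := v * ((x⁻¹ : Aˣ) * s) with hb
  have hvb : v * b = b := by rw [hb, ← mul_assoc, hu2]
  set c := t * v with hc
  have hcv : c * v = c := by rw [hc, mul_assoc, hu2]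
  have hbc : b * c = v := by rw [hb, mul_assoc, hb0, hu2]
  have hπb : π b = π s := by simp [hb, hπv, hπx']
  have hπc : π c = π t := by simp [hc, hπv]
  have hee : (c * b) * (c * b) = c * b := by
    calc (c * b) * (c * b) = c * (b * c) * b := by noncomm_ring
      _ = c * b := by rw [hbc, hcv]
  have hec : (c * b) * c = c := by rw [mul_assoc, hbc, hcv]
  set e := c * b with he
  have hπe : π e = 1 := by rw [he, map_mul, hπb, hπc, h2]
  have hπes : π (star e) = 1 := by
    have : star (e - 1) ∈ F := hF.star_mem _ ((hπ _).1 (by simp [hπe]))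
    rw [← hπ] at this
    simpa [sub_eq_zero] using this
  obtain ⟨w, hw, hP, hPe, heP⟩ := range_proj e hee
  have hπw : π w = 1 := by
    have := congrArg π hw
    simpa [hπe, hπes] using this
  have hπP : π (e * star e * w) = 1 := by simp [hπe, hπes, hπw]
  generalize e * star e * w = P at *
  have hPc : P * c = c := by
    rw [← hec, ← mul_assoc, hPe]
  refine ⟨u, 1 - P, huF, (hπ _).1 (by simp [hπP]), hup, isProjection_one_sub hP, b * P, ?_⟩
  have k : (1 - (1 - P)) * t * (1 - u) = c := by
    rw [sub_sub_cancel, ← hv, mul_assoc, ← hc, hPc]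
  refine ⟨?_, ?_, ?_⟩
  · rw [sub_sub_cancel, ← hv, ← mul_assoc, hvb, mul_assoc b, hP.2]
  · rw [k, sub_sub_cancel, ← mul_assoc, heP]
  · rw [k, ← hv, mul_assoc, hPc, hbc]

/-- Algebraic equivalence of projections implies Murray and von Neumann equivalence. -/
theorem mvn_of_alg {B : Type*} [CStarAlgebra B] {P Q X Y : B} (hP : IsProjection P)
    (hQ : IsProjection Q) (hXY : X * Y = P) (hYX : Y * X = Q) (hX : P * X = X) (hX' : X * Q = X)
    (hY' : Y * P = Y) : MvNEquiv P Q := by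
  let : PartialOrder B := CStarAlgebra.spectralOrder B
  let : StarOrderedRing B := CStarAlgebra.spectralOrderedRing B
  set a := Y * star Y + (1 - Q) with ha
  have ha0 : 0 ≤ a := by
    have h := isProjection_one_sub hQ
    have : (1 - Q) = star (1 - Q) * (1 - Q) := by rw [h.1, h.2]
    rw [ha, this]
    exact add_nonneg (mul_star_self_nonneg Y) (star_mul_self_nonneg _)
  have hXs : Q * star X = star X := by
    have := congrArg star hX'
    simpa [hQ.1] using this
  have e1 : star X * X * a = Q := by
    rw [ha, mul_add]
    have : star X * X * (1 - Q) = 0 := by rw [mul_assoc, mul_sub, hX', mul_one, sub_self, mul_zero]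
    rw [this, add_zero]
    calc star X * X * (Y * star Y) = star X * (X * Y) * star Y := by noncomm_ring
      _ = star (Y * P * X) := by rw [hXY]; simp [hP.1, mul_assoc]
      _ = Q := by rw [hY', hYX, hQ.1]
  have has : star a = a := by simp [ha, hQ.1]
  have e2 : a * (star X * X) = Q := by
    have := congrArg star e1
    simpa [has, hQ.1] using this
  have hc : CFC.sqrt a * CFC.sqrt a = a := CFC.sqrt_mul_sqrt_self a ha0
  have hcs : star (CFC.sqrt a) = CFC.sqrt a := (CFC.sqrt_nonneg a).isSelfAdjoint
  have hcom : Commute (CFC.sqrt a) (star X * X) := by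
    have : Commute a (star X * X) := e2.trans e1.symm
    exact this.cfcₙ_nnreal _
  refine ⟨X * CFC.sqrt a, ?_, ?_⟩
  · rw [star_mul, hcs]
    calc X * CFC.sqrt a * (CFC.sqrt a * star X) = X * (CFC.sqrt a * CFC.sqrt a) * star X := by
          noncomm_ring
      _ = (X * Y) * star (X * Y) + (X - X * Q) * star X := by
          rw [hc, ha, star_mul]; noncomm_ring
      _ = P := by rw [hX', sub_self, zero_mul, add_zero, hXY, hP.1, hP.2]
  · rw [star_mul, hcs]
    calc CFC.sqrt a * star X * (X * CFC.sqrt a) = CFC.sqrt a * (star X * X) * CFC.sqrt a := by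
          noncomm_ring
      _ = Q := by rw [hcom.eq, mul_assoc, hc, e1]

/-- Cancellation of a common projection `J` that almost reduces the equivalence `Z`. -/
theorem mvn_cancel {B : Type*} [CStarAlgebra B] {P Q Z Y J : B} (hP : IsProjection P)
    (hQ : IsProjection Q) (hJ : IsProjection J) (hZY : Z * Y = Q) (hYZ : Y * Z = P)
    (hQZ : Q * Z = Z) (hZP : Z * P = Z) (hPY : P * Y = Y) (hYQ : Y * Q = Y)
    (hJP : J * P = J) (hPJ : P * J = J) (hJQ : J * Q = J) (hQJ : Q * J = J)
    (n1 : ‖J * Z * (1 - J)‖ * ‖Y‖ < 1) (n2 : ‖(1 - J) * Z * J‖ * ‖Y‖ < 1) :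
    MvNEquiv (Q - J) (P - J) := by
  have hE := isProjection_one_sub hJ
  have hEn := proj_norm_le hE
  have hQE : Q * (1 - J) = Q - J := by rw [mul_sub, hQJ, mul_one]
  have hEQ : (1 - J) * Q = Q - J := by rw [sub_mul, hJQ, one_mul]
  have hPE : P * (1 - J) = P - J := by rw [mul_sub, hPJ, mul_one]
  have hEP : (1 - J) * P = P - J := by rw [sub_mul, hJP, one_mul]
  have hJE : J = 1 - (1 - J) := by noncomm_ring
  set E := 1 - J with hEdef
  have hQJp : IsProjection (Q - J) :=
    ⟨by rw [star_sub, hQ.1, hJ.1], by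
      simp only [mul_sub, sub_mul, hQ.2, hQJ, hJQ, hJ.2]; abel⟩
  have hPJp : IsProjection (P - J) :=
    ⟨by rw [star_sub, hP.1, hJ.1], by
      simp only [mul_sub, sub_mul, hP.2, hPJ, hJP, hJ.2]; abel⟩
  set S1 := E * Z * J * Y * E with hS1
  set S2 := E * Y * (J * Z * E) with hS2
  have s1 : ‖S1‖ < 1 := by
    calc ‖S1‖ ≤ ‖E * Z * J * Y‖ * ‖E‖ := norm_mul_le _ _
      _ ≤ ‖E * Z * J * Y‖ * 1 := by gcongr
      _ ≤ ‖E * Z * J‖ * ‖Y‖ := by rw [mul_one]; exact norm_mul_le _ _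
      _ < 1 := n2
  have s2 : ‖S2‖ < 1 := by
    calc ‖S2‖ ≤ ‖E * Y‖ * ‖J * Z * E‖ := norm_mul_le _ _
      _ ≤ (‖E‖ * ‖Y‖) * ‖J * Z * E‖ := by gcongr; exact norm_mul_le _ _
      _ ≤ (1 * ‖Y‖) * ‖J * Z * E‖ := by gcongr
      _ = ‖J * Z * E‖ * ‖Y‖ := by ring
      _ < 1 := n1
  obtain ⟨x, hx⟩ : IsUnit (1 - S1) := (Units.oneSub _ s1).isUnit
  obtain ⟨y, hy⟩ : IsUnit (1 - S2) := (Units.oneSub _ s2).isUnit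
  have hEQE : E * Q * E = Q - J := by rw [hEQ, ← hQE, mul_assoc, hE.2]
  have hEPE : E * P * E = P - J := by rw [hEP, ← hPE, mul_assoc, hE.2]
  set M := E * Z * E with hM
  set N := E * Y * E with hN
  have qM : (Q - J) * M = M := by
    rw [← hQE, hM]
    calc Q * E * (E * Z * E) = Q * (E * E) * Z * E := by noncomm_ring
      _ = E * (Q * Z) * E := by rw [hE.2, hQE, ← hEQ]; noncomm_ring
      _ = _ := by rw [hQZ]
  have Mp : M * (P - J) = M := by
    rw [← hEP, hM]
    calc E * Z * E * (E * P) = E * Z * ((E * E) * P) := by noncomm_ring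
      _ = E * (Z * P) * E := by rw [hE.2, hEP, ← hPE]; noncomm_ring
      _ = _ := by rw [hZP]
  have pN : (P - J) * N = N := by
    rw [← hPE, hN]
    calc P * E * (E * Y * E) = P * (E * E) * Y * E := by noncomm_ring
      _ = E * (P * Y) * E := by rw [hE.2, hPE, ← hEP]; noncomm_ring
      _ = _ := by rw [hPY]
  have Nq : N * (Q - J) = N := by
    rw [← hEQ, hN]
    calc E * Y * E * (E * Q) = E * Y * ((E * E) * Q) := by noncomm_ring
      _ = E * (Y * Q) * E := by rw [hE.2, hEQ, ← hQE]; noncomm_ring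
      _ = _ := by rw [hYQ]
  have MN : M * N = (Q - J) - S1 := by
    calc M * N = E * Z * (E * E) * Y * E := by rw [hM, hN]; noncomm_ring
      _ = E * (Z * Y) * E - S1 := by rw [hE.2, hS1, hJE]; noncomm_ring
      _ = _ := by rw [hZY, hEQE]
  have NM : N * M = (P - J) - S2 := by
    calc N * M = E * Y * (E * E) * Z * E := by rw [hM, hN]; noncomm_ring
      _ = E * (Y * Z) * E - S2 := by rw [hE.2, hS2, hJE]; noncomm_ring
      _ = _ := by rw [hYZ, hEPE]
  clear_value M N S1 S2
  set q := Q - J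
  set p := P - J
  have MN' : M * N = q * x := by
    rw [hx, mul_sub, mul_one]
    have : q * (M * N) = M * N := by rw [← mul_assoc, qM]
    rw [MN, mul_sub, hQJp.2] at this
    rw [MN, this]
  have NM' : N * M = y * p := by
    rw [hy, sub_mul, one_mul]
    have : (N * M) * p = N * M := by rw [mul_assoc, Mp]
    rw [NM, sub_mul, hPJp.2] at this
    rw [NM, this]
  have R : M * (N * (x⁻¹ : Bˣ)) = q := by
    rw [← mul_assoc, MN', mul_assoc, x.mul_inv, mul_one]
  have L : (y⁻¹ : Bˣ) * N * M = p := by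
    rw [mul_assoc, NM', ← mul_assoc, y.inv_mul, one_mul]
  have pR : p * (N * (x⁻¹ : Bˣ)) = N * (x⁻¹ : Bˣ) := by rw [← mul_assoc, pN]
  have Lq : (y⁻¹ : Bˣ) * N * q = (y⁻¹ : Bˣ) * N := by rw [mul_assoc, Nq]
  have eq : N * (x⁻¹ : Bˣ) = (y⁻¹ : Bˣ) * N := by
    rw [← pR, ← L, mul_assoc _ M, R, Lq]
  exact mvn_of_alg hQJp hPJp R (by rw [eq, L]) qM Mp (by rw [eq, Lq])

theorem fredholm_data {A : Type*} [CStarAlgebra A] {F : Set A}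
    {B : Type*} [Ring B] (π : A →+* B) (hπ : ∀ x, π x = 0 ↔ x ∈ F) {t p q : A}
    (hpF : p ∈ F) (hqF : q ∈ F) (hp : IsProjection p) (hq : IsProjection q)
    (h : InvUpTo t p q) :
    ∃ t' b : A, t' * b = 1 - q ∧ b * t' = 1 - p ∧ p * b = 0 ∧ b * q = 0 ∧ q * t' = 0 ∧
      t' * p = 0 ∧ π t' = π t ∧ π b * π t = 1 ∧ π t * π b = 1 := by
  obtain ⟨b, h1, h2, h3⟩ := h
  have hπp := (hπ p).2 hpF
  have hπq := (hπ q).2 hqF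
  have hp0 : p * (1 - p) = 0 := by rw [mul_sub, hp.2, mul_one, sub_self]
  have hp1 : (1 - p) * p = 0 := by rw [sub_mul, hp.2, one_mul, sub_self]
  have hq0 : q * (1 - q) = 0 := by rw [mul_sub, hq.2, mul_one, sub_self]
  have hq1 : (1 - q) * q = 0 := by rw [sub_mul, hq.2, one_mul, sub_self]
  refine ⟨(1 - q) * t * (1 - p), b, h2, h3, ?_, ?_, ?_, ?_, ?_, ?_, ?_⟩
  · rw [h1, ← mul_assoc, ← mul_assoc, hp0, zero_mul, zero_mul]
  · rw [h1, mul_assoc, hq1, mul_zero]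
  · rw [← mul_assoc, ← mul_assoc, hq0, zero_mul, zero_mul]
  · rw [mul_assoc, hp1, mul_zero]
  · simp [hπp, hπq]
  · simpa [hπp, hπq] using congrArg π h3
  · simpa [hπp, hπq] using congrArg π h2

/-- Elements of the corner `(3,3)`. -/
theorem corner_small {A : Type*} [CStarAlgebra A] [PartialOrder A] [StarOrderedRing A]
    (ε : ℝ) (hε : 0 < ε) : ∃ δ > 0, ∀ a : A, ‖a‖ < δ →
      ‖CStarMatrix.ofMatrix (Matrix.diagonal ![0, 0, 0, a] : Matrix (Fin 4) (Fin 4) A)‖ < ε := by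
  have hc : Continuous (fun a : A =>
      CStarMatrix.ofMatrix (Matrix.diagonal ![0, 0, 0, a] : Matrix (Fin 4) (Fin 4) A)) := by
    have : Continuous (fun a : A => (Matrix.diagonal ![0, 0, 0, a] : Matrix (Fin 4) (Fin 4) A)) := by
      apply Continuous.matrix_diagonal
      refine continuous_pi fun i => ?_
      fin_cases i <;> simp <;> fun_prop
    exact this
  have h0 : CStarMatrix.ofMatrix (Matrix.diagonal ![0, 0, 0, (0 : A)] : Matrix (Fin 4) (Fin 4) A)
      = 0 := by
    ext i j
    fin_cases i <;> fin_cases j <;> rfl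
  obtain ⟨δ, hδ, h⟩ := Metric.continuous_iff.1 hc 0 ε hε
  refine ⟨δ, hδ, fun a ha => ?_⟩
  have := h a (by simpa using ha)
  rw [h0, dist_zero_right] at this
  exact this

set_option maxHeartbeats 2000000 in
theorem alg_part {A : Type*} [Ring A] {p₁ q₁ p₂ q₂ p₃ q₃ s₁ b₁ s₂ b₂ s₃ b₃ : A}
    {B : Type*} [Ring B] (π : A →+* B)
    (hp₁ : p₁ * p₁ = p₁) (hq₁ : q₁ * q₁ = q₁) (hp₂ : p₂ * p₂ = p₂) (hq₂ : q₂ * q₂ = q₂)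
    (hp₃ : p₃ * p₃ = p₃) (hq₃ : q₃ * q₃ = q₃)
    (πp₁ : π p₁ = 0) (πq₁ : π q₁ = 0) (πp₂ : π p₂ = 0) (πq₂ : π q₂ = 0) (πp₃ : π p₃ = 0)
    (πq₃ : π q₃ = 0)
    (h₁ : s₁ * b₁ = 1 - q₁ ∧ b₁ * s₁ = 1 - p₁ ∧ p₁ * b₁ = 0 ∧ b₁ * q₁ = 0 ∧ q₁ * s₁ = 0 ∧
      s₁ * p₁ = 0)
    (h₂ : s₂ * b₂ = 1 - q₂ ∧ b₂ * s₂ = 1 - p₂ ∧ p₂ * b₂ = 0 ∧ b₂ * q₂ = 0 ∧ q₂ * s₂ = 0 ∧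
      s₂ * p₂ = 0)
    (h₃ : s₃ * b₃ = 1 - q₃ ∧ b₃ * s₃ = 1 - p₃ ∧ p₃ * b₃ = 0 ∧ b₃ * q₃ = 0 ∧ q₃ * s₃ = 0 ∧
      s₃ * p₃ = 0)
    (hπ : π b₃ * (π s₁ * π s₂) = 1) :
    ∃ Z Y : Matrix (Fin 4) (Fin 4) A,
      Z * Y = Matrix.diagonal ![q₃, p₁, p₂, 1] ∧ Y * Z = Matrix.diagonal ![p₃, q₁, q₂, 1] ∧
      Matrix.diagonal ![q₃, p₁, p₂, 1] * Z = Z ∧ Z * Matrix.diagonal ![p₃, q₁, q₂, 1] = Z ∧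
      Matrix.diagonal ![p₃, q₁, q₂, 1] * Y = Y ∧ Y * Matrix.diagonal ![q₃, p₁, p₂, 1] = Y ∧
      ∀ i j, π ((Z - Matrix.diagonal ![0, 0, 0, 1] : Matrix (Fin 4) (Fin 4) A) i j) = 0 := by
  obtain ⟨a1, a2, a3, a4, a5, a6⟩ := h₁
  obtain ⟨c1, c2, c3, c4, c5, c6⟩ := h₂
  obtain ⟨d1, d2, d3, d4, d5, d6⟩ := h₃
  let D0 : Matrix (Fin 4) (Fin 4) A := Matrix.diagonal ![p₃, q₁, q₂, 1]
  let D1 : Matrix (Fin 4) (Fin 4) A := Matrix.diagonal ![p₃, q₁, p₂, 1]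
  let D2 : Matrix (Fin 4) (Fin 4) A := Matrix.diagonal ![p₃, p₁, p₂, 1]
  let D3 : Matrix (Fin 4) (Fin 4) A := Matrix.diagonal ![q₃, p₁, p₂, 1]
  let U2 : Matrix (Fin 4) (Fin 4) A := !![p₃, 0, 0, 0; 0, q₁, 0, 0; 0, 0, 0, p₂; 0, 0, q₂, s₂]
  let V2 : Matrix (Fin 4) (Fin 4) A := !![p₃, 0, 0, 0; 0, q₁, 0, 0; 0, 0, 0, q₂; 0, 0, p₂, b₂]
  let U1 : Matrix (Fin 4) (Fin 4) A := !![p₃, 0, 0, 0; 0, 0, 0, p₁; 0, 0, p₂, 0; 0, q₁, 0, s₁]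
  let V1 : Matrix (Fin 4) (Fin 4) A := !![p₃, 0, 0, 0; 0, 0, 0, q₁; 0, 0, p₂, 0; 0, p₁, 0, b₁]
  let U3 : Matrix (Fin 4) (Fin 4) A := !![0, 0, 0, p₃; 0, p₁, 0, 0; 0, 0, p₂, 0; q₃, 0, 0, s₃]
  let V3 : Matrix (Fin 4) (Fin 4) A := !![0, 0, 0, q₃; 0, p₁, 0, 0; 0, 0, p₂, 0; p₃, 0, 0, b₃]
  have r2 : U2 * V2 = D1 := by
    ext i j; fin_cases i <;> fin_cases j <;>
      simp [U2, V2, D1, Matrix.mul_apply, Fin.sum_univ_four, *]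
  have l2 : V2 * U2 = D0 := by
    ext i j; fin_cases i <;> fin_cases j <;>
      simp [U2, V2, D0, Matrix.mul_apply, Fin.sum_univ_four, *]
  have r1 : U1 * V1 = D2 := by
    ext i j; fin_cases i <;> fin_cases j <;>
      simp [U1, V1, D2, Matrix.mul_apply, Fin.sum_univ_four, *]
  have l1 : V1 * U1 = D1 := by
    ext i j; fin_cases i <;> fin_cases j <;>
      simp [U1, V1, D1, Matrix.mul_apply, Fin.sum_univ_four, *]
  have r3 : U3 * V3 = D2 := by
    ext i j; fin_cases i <;> fin_cases j <;>
      simp [U3, V3, D2, Matrix.mul_apply, Fin.sum_univ_four, *]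
  have l3 : V3 * U3 = D3 := by
    ext i j; fin_cases i <;> fin_cases j <;>
      simp [U3, V3, D3, Matrix.mul_apply, Fin.sum_univ_four, *]
  have x1 : D1 * U2 = U2 := by
    ext i j; fin_cases i <;> fin_cases j <;> simp [U2, D1, *]
  have x2 : U2 * D0 = U2 := by
    ext i j; fin_cases i <;> fin_cases j <;> simp [U2, D0, *]
  have x3 : D0 * V2 = V2 := by
    ext i j; fin_cases i <;> fin_cases j <;> simp [V2, D0, *]
  have x5 : D2 * U1 = U1 := by
    ext i j; fin_cases i <;> fin_cases j <;> simp [U1, D2, *]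
  have x6 : D1 * V1 = V1 := by
    ext i j; fin_cases i <;> fin_cases j <;> simp [V1, D1, *]
  have x7 : D3 * V3 = V3 := by
    ext i j; fin_cases i <;> fin_cases j <;> simp [V3, D3, *]
  have x8 : D2 * U3 = U3 := by
    ext i j; fin_cases i <;> fin_cases j <;> simp [U3, D2, *]
  have x9 : U3 * D3 = U3 := by
    ext i j; fin_cases i <;> fin_cases j <;> simp [U3, D3, *]
  refine ⟨V3 * (U1 * U2), V2 * (V1 * U3), ?_, ?_, ?_, ?_, ?_, ?_, ?_⟩
  · calc V3 * (U1 * U2) * (V2 * (V1 * U3)) = V3 * (U1 * (U2 * V2 * V1) * U3) := by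
          simp only [Matrix.mul_assoc]
      _ = D3 := by rw [r2, x6, r1, x8, l3]
  · calc V2 * (V1 * U3) * (V3 * (U1 * U2)) = V2 * (V1 * (U3 * V3 * U1) * U2) := by
          simp only [Matrix.mul_assoc]
      _ = D0 := by rw [r3, x5, l1, x1, l2]
  · change D3 * _ = _
    rw [← Matrix.mul_assoc, x7]
  · change _ * D0 = _
    rw [Matrix.mul_assoc, Matrix.mul_assoc, x2]
  · change D0 * _ = _
    rw [← Matrix.mul_assoc, x3]
  · change _ * D3 = _
    rw [Matrix.mul_assoc, Matrix.mul_assoc, x9]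
  · have mU1 : π.mapMatrix U1 = Matrix.diagonal ![0, 0, 0, π s₁] := by
      ext i j; fin_cases i <;> fin_cases j <;> simp [U1, πp₁, πq₁, πp₂, πp₃]
    have mU2 : π.mapMatrix U2 = Matrix.diagonal ![0, 0, 0, π s₂] := by
      ext i j; fin_cases i <;> fin_cases j <;> simp [U2, πq₁, πp₂, πq₂, πp₃]
    have mV3 : π.mapMatrix V3 = Matrix.diagonal ![0, 0, 0, π b₃] := by
      ext i j; fin_cases i <;> fin_cases j <;> simp [V3, πp₁, πp₂, πp₃, πq₃]
    have mE : π.mapMatrix (Matrix.diagonal ![0, 0, 0, 1] : Matrix (Fin 4) (Fin 4) A) =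
        Matrix.diagonal ![0, 0, 0, 1] := by
      ext i j; fin_cases i <;> fin_cases j <;> simp
    have key : π.mapMatrix (V3 * (U1 * U2) - Matrix.diagonal ![0, 0, 0, 1]) = 0 := by
      rw [map_sub, map_mul, map_mul, mU1, mU2, mV3, mE, Matrix.diagonal_mul_diagonal,
        Matrix.diagonal_mul_diagonal, sub_eq_zero]
      congr 1
      ext i; fin_cases i <;> simp [hπ]
    intro i j
    exact congrFun (congrFun key i) j

theorem index_part {A : Type*} [CStarAlgebra A] {F : Set A} (hF : IsFiniteType F)
    {B : Type*} [Ring B] (π : A →+* B) (hπ : ∀ x, π x = 0 ↔ x ∈ F)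
    {t₁ t₂ p₁ q₁ p₂ q₂ p₃ q₃ : A}
    (f1 : p₁ ∈ F) (f2 : q₁ ∈ F) (f3 : p₂ ∈ F) (f4 : q₂ ∈ F) (f5 : p₃ ∈ F) (f6 : q₃ ∈ F)
    (g1 : IsProjection p₁) (g2 : IsProjection q₁) (g3 : IsProjection p₂) (g4 : IsProjection q₂)
    (g5 : IsProjection p₃) (g6 : IsProjection q₃)
    (i1 : InvUpTo t₁ p₁ q₁) (i2 : InvUpTo t₂ p₂ q₂) (i3 : InvUpTo (t₁ * t₂) p₃ q₃) :
    KDiffAddEq F p₁ q₁ p₂ q₂ p₃ q₃ := by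
  let _ : PartialOrder A := CStarAlgebra.spectralOrder A
  let _ : StarOrderedRing A := CStarAlgebra.spectralOrderedRing A
  obtain ⟨s₁, b₁, a1, a2, a3, a4, a5, a6, a7, a8, a9⟩ := fredholm_data π hπ f1 f2 g1 g2 i1
  obtain ⟨s₂, b₂, c1, c2, c3, c4, c5, c6, c7, c8, c9⟩ := fredholm_data π hπ f3 f4 g3 g4 i2
  obtain ⟨s₃, b₃, d1, d2, d3, d4, d5, d6, d7, d8, d9⟩ := fredholm_data π hπ f5 f6 g5 g6 i3
  obtain ⟨Z, Y, hZY, hYZ, hQZ, hZP, hPY, hYQ, hG⟩ := alg_part π g1.2 g2.2 g3.2 g4.2 g5.2 g6.2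
    ((hπ _).2 f1) ((hπ _).2 f2) ((hπ _).2 f3) ((hπ _).2 f4) ((hπ _).2 f5) ((hπ _).2 f6)
    ⟨a1, a2, a3, a4, a5, a6⟩ ⟨c1, c2, c3, c4, c5, c6⟩ ⟨d1, d2, d3, d4, d5, d6⟩
    (by rw [a7, c7, ← map_mul π t₁ t₂, d8])
  let Φ := CStarMatrix.ofMatrixStarAlgEquiv (n := Fin 4) (A := A)
  set G : Matrix (Fin 4) (Fin 4) A := Z - Matrix.diagonal ![0, 0, 0, 1] with hGdef
  have hGF : ∀ i j, G i j ∈ F := fun i j => (hπ _).1 (hG i j)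
  obtain ⟨ε, hε, hεY⟩ : ∃ ε > 0, ε * ‖Φ Y‖ < 1 := by
    refine ⟨(‖Φ Y‖ + 1)⁻¹, by positivity, ?_⟩
    rw [inv_mul_lt_one₀ (by positivity)]
    linarith
  obtain ⟨δ, hδ, hsmall⟩ := corner_small (A := A) (ε ^ 2) (by positivity)
  set g : A := (G * star G) 3 3 with hg
  set g' : A := (star G * G) 3 3 with hg'
  have hgF : g ∈ F := by
    rw [hg, Matrix.mul_apply, Fin.sum_univ_four]
    refine hF.add_mem _ (hF.add_mem _ (hF.add_mem _ ?_ _ ?_) _ ?_) _ ?_ <;>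
      exact hF.mul_mem_right _ _ (hGF _ _)
  have hgF' : g' ∈ F := by
    rw [hg', Matrix.mul_apply, Fin.sum_univ_four]
    refine hF.add_mem _ (hF.add_mem _ (hF.add_mem _ ?_ _ ?_) _ ?_) _ ?_ <;>
      exact hF.mul_mem_left _ _ (hGF _ _)
  obtain ⟨ι, rel, u, hu⟩ := hF.approx_unit
  obtain ⟨α, hα⟩ := hu.approx g hgF δ hδ
  obtain ⟨β, hβ⟩ := hu.approx g' hgF' δ hδ
  obtain ⟨γ, hγ1, hγ2⟩ := hu.directed α β
  have k1 := hα γ hγ1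
  have k2 := hβ γ hγ2
  have hr := hu.proj γ
  have hrF := hu.mem γ
  generalize u γ = r at *
  have hr' := isProjection_one_sub hr
  set J : Matrix (Fin 4) (Fin 4) A := Matrix.diagonal ![0, 0, 0, 1 - r] with hJ
  have diagstar : ∀ a b c d : A, star (Matrix.diagonal ![a, b, c, d] : Matrix (Fin 4) (Fin 4) A) =
      Matrix.diagonal ![star a, star b, star c, star d] := by
    intro a b c d
    rw [Matrix.star_eq_conjTranspose, Matrix.diagonal_conjTranspose]
    congr 1
    ext i; fin_cases i <;> rfl
  have diagmul : ∀ a b c d a' b' c' d' : A,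
      (Matrix.diagonal ![a, b, c, d] * Matrix.diagonal ![a', b', c', d'] :
        Matrix (Fin 4) (Fin 4) A) = Matrix.diagonal ![a * a', b * b', c * c', d * d'] := by
    intro a b c d a' b' c' d'
    rw [Matrix.diagonal_mul_diagonal]
    congr 1
    ext i; fin_cases i <;> rfl
  have diagsub : ∀ a b c d a' b' c' d' : A,
      (Matrix.diagonal ![a, b, c, d] - Matrix.diagonal ![a', b', c', d'] :
        Matrix (Fin 4) (Fin 4) A) = Matrix.diagonal ![a - a', b - b', c - c', d - d'] := by
    intro a b c d a' b' c' d'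
    rw [Matrix.diagonal_sub]
    congr 1
    ext i; fin_cases i <;> rfl
  have dp : ∀ a b c d : A, IsProjection a → IsProjection b → IsProjection c → IsProjection d →
      IsProjection (Φ (Matrix.diagonal ![a, b, c, d])) := by
    intro a b c d ha hb hc hd
    refine ⟨?_, ?_⟩
    · rw [← map_star, diagstar, ha.1, hb.1, hc.1, hd.1]
    · rw [← map_mul, diagmul, ha.2, hb.2, hc.2, hd.2]
  have z0 : IsProjection (0 : A) := ⟨by simp, by simp⟩
  have o0 : IsProjection (1 : A) := ⟨by simp, by simp⟩
  have hJp : IsProjection (Φ J) := dp _ _ _ _ z0 z0 z0 hr'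
  have hEn := proj_norm_le (isProjection_one_sub hJp)
  have hv := proj_norm_le hr'
  have corner : ∀ M : Matrix (Fin 4) (Fin 4) A, J * M * J =
      Matrix.diagonal ![0, 0, 0, (1 - r) * M 3 3 * (1 - r)] := by
    intro M
    ext i j
    fin_cases i <;> fin_cases j <;> simp [hJ]
  have aux : ∀ a : A, ‖a - r * a‖ < δ → ‖(1 - r) * a * (1 - r)‖ < δ := by
    intro a ha
    calc ‖(1 - r) * a * (1 - r)‖ ≤ ‖(1 - r) * a‖ * ‖1 - r‖ := norm_mul_le _ _
      _ ≤ ‖(1 - r) * a‖ * 1 := by gcongr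
      _ = ‖a - r * a‖ := by rw [mul_one, sub_mul, one_mul]
      _ < δ := ha
  have m1 : ‖Φ J * Φ G‖ < ε := by
    have : ‖(Φ J * Φ G) * star (Φ J * Φ G)‖ < ε ^ 2 := by
      have e : (Φ J * Φ G) * star (Φ J * Φ G) = Φ (J * (G * star G) * J) := by
        rw [star_mul, hJp.1]
        simp only [map_mul, map_star, mul_assoc]
      rw [e, corner]
      exact hsmall _ (aux _ k1)
    rw [CStarRing.norm_self_mul_star, ← sq] at this
    exact lt_of_pow_lt_pow_left₀ 2 hε.le this
  have m2 : ‖Φ G * Φ J‖ < ε := by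
    have : ‖star (Φ G * Φ J) * (Φ G * Φ J)‖ < ε ^ 2 := by
      have e : star (Φ G * Φ J) * (Φ G * Φ J) = Φ (J * (star G * G) * J) := by
        rw [star_mul, hJp.1]
        simp only [map_mul, map_star, mul_assoc]
      rw [e, corner]
      exact hsmall _ (aux _ k2)
    rw [CStarRing.norm_star_mul_self, ← sq] at this
    exact lt_of_pow_lt_pow_left₀ 2 hε.le this
  have hZG : Φ Z = Φ G + Φ (Matrix.diagonal ![0, 0, 0, 1]) := by
    rw [← map_add, hGdef, sub_add_cancel]
  have hJe : Φ J * Φ (Matrix.diagonal ![0, 0, 0, 1]) = Φ J := by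
    rw [← map_mul, hJ, diagmul]; simp
  have heJ : Φ (Matrix.diagonal ![0, 0, 0, 1]) * Φ J = Φ J := by
    rw [← map_mul, hJ, diagmul]; simp
  have n1 : ‖Φ J * Φ Z * (1 - Φ J)‖ * ‖Φ Y‖ < 1 := by
    have e : Φ J * Φ Z * (1 - Φ J) = Φ J * Φ G * (1 - Φ J) := by
      rw [hZG, mul_add, hJe, add_mul, mul_sub (Φ J) 1, hJp.2, mul_one, sub_self, add_zero]
    rw [e]
    refine lt_of_le_of_lt ?_ hεY
    gcongr
    calc ‖Φ J * Φ G * (1 - Φ J)‖ ≤ ‖Φ J * Φ G‖ * ‖1 - Φ J‖ := norm_mul_le _ _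
      _ ≤ ε * 1 := by gcongr
      _ = ε := mul_one _
  have n2 : ‖(1 - Φ J) * Φ Z * Φ J‖ * ‖Φ Y‖ < 1 := by
    have e : (1 - Φ J) * Φ Z * Φ J = (1 - Φ J) * (Φ G * Φ J) := by
      rw [hZG, mul_assoc, add_mul, heJ, mul_add, sub_mul 1 (Φ J) (Φ J), hJp.2, one_mul, sub_self,
        add_zero]
    rw [e]
    refine lt_of_le_of_lt ?_ hεY
    gcongr
    calc ‖(1 - Φ J) * (Φ G * Φ J)‖ ≤ ‖1 - Φ J‖ * ‖Φ G * Φ J‖ := norm_mul_le _ _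
      _ ≤ 1 * ε := by gcongr
      _ = ε := one_mul _
  obtain ⟨v, hv1, hv2⟩ := mvn_cancel (P := Φ (Matrix.diagonal ![p₃, q₁, q₂, 1]))
    (Q := Φ (Matrix.diagonal ![q₃, p₁, p₂, 1])) (Z := Φ Z) (Y := Φ Y) (J := Φ J)
    (dp _ _ _ _ g5 g2 g4 o0) (dp _ _ _ _ g6 g1 g3 o0) hJp
    (by rw [← map_mul, hZY]) (by rw [← map_mul, hYZ]) (by rw [← map_mul, hQZ])
    (by rw [← map_mul, hZP]) (by rw [← map_mul, hPY]) (by rw [← map_mul, hYQ])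
    (by rw [← map_mul, hJ, diagmul]; simp) (by rw [← map_mul, hJ, diagmul]; simp)
    (by rw [← map_mul, hJ, diagmul]; simp) (by rw [← map_mul, hJ, diagmul]; simp) n1 n2
  rw [← map_sub, hJ, diagsub] at hv1 hv2
  simp only [sub_zero, sub_sub_cancel] at hv1 hv2
  obtain ⟨V, rfl⟩ : ∃ V, Φ V = v := EquivLike.surjective Φ v
  rw [← map_star, ← map_mul] at hv1 hv2
  have hv1' := EquivLike.injective Φ hv1
  have hv2' := EquivLike.injective Φ hv2
  exact ⟨r, hrF, hr, star V, by rw [star_star]; exact hv2', by rw [star_star]; exact hv1'⟩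

/-- The index theorem: if `t₁` and `t₂` are of Fredholm type, then so is
`t₁ t₂`, and `ind (t₁ t₂) = ind t₁ + ind t₂` in `K(F)`. -/
theorem index_theorem
    {A : Type*} [NormedRing A] [StarRing A] [CStarRing A] [CompleteSpace A]
    [NormedAlgebra ℂ A] [StarModule ℂ A]
    (F : Set A) (hF : IsFiniteType F) (t₁ t₂ : A)
    (h₁ : ∃ p q : A, p ∈ F ∧ q ∈ F ∧ IsProjection p ∧ IsProjection q ∧
      InvUpTo t₁ p q)
    (h₂ : ∃ p q : A, p ∈ F ∧ q ∈ F ∧ IsProjection p ∧ IsProjection q ∧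
      InvUpTo t₂ p q) :
    (∃ p q : A, p ∈ F ∧ q ∈ F ∧ IsProjection p ∧ IsProjection q ∧
      InvUpTo (t₁ * t₂) p q) ∧
    ∀ p₁ q₁ p₂ q₂ p₃ q₃ : A,
      p₁ ∈ F → q₁ ∈ F → p₂ ∈ F → q₂ ∈ F → p₃ ∈ F → q₃ ∈ F →
      IsProjection p₁ → IsProjection q₁ → IsProjection p₂ → IsProjection q₂ →
      IsProjection p₃ → IsProjection q₃ →
      InvUpTo t₁ p₁ q₁ → InvUpTo t₂ p₂ q₂ → InvUpTo (t₁ * t₂) p₃ q₃ →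
      KDiffAddEq F p₁ q₁ p₂ q₂ p₃ q₃ := by

  let _ : CStarAlgebra A := { }
  obtain ⟨B, _, π, hπ⟩ := exists_quot (A := A) hF
  refine ⟨?_, ?_⟩
  · obtain ⟨p₁, q₁, f1, f2, g1, g2, i1⟩ := h₁
    obtain ⟨p₂, q₂, f3, f4, g3, g4, i2⟩ := h₂
    obtain ⟨s₁, b₁, -, -, -, -, -, -, -, a8, a9⟩ := fredholm_data π hπ f1 f2 g1 g2 i1
    obtain ⟨s₂, b₂, -, -, -, -, -, -, -, c8, c9⟩ := fredholm_data π hπ f3 f4 g3 g4 i2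
    refine fredholm_of_inv hF π hπ (t₁ * t₂) (b₂ * b₁) ?_ ?_
    · rw [map_mul, map_mul, mul_assoc, ← mul_assoc (π b₁), a8, one_mul, c8]
    · rw [map_mul, map_mul, mul_assoc, ← mul_assoc (π t₂), c9, one_mul, a9]
  · intro p₁ q₁ p₂ q₂ p₃ q₃ f1 f2 f3 f4 f5 f6 g1 g2 g3 g4 g5 g6 i1 i2 i3
    exact index_part hF π hπ f1 f2 f3 f4 f5 f6 g1 g2 g3 g4 g5 g6 i1 i2 i3
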